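/- arXiv:1509.03230 — 4 statements merged into one kernel-verified Lean document; each statement's English description precedes it below -/
import Mathlib

section
/- Let n ≥ 1 and let X ⊆ [0,1]^n be a nonempty closed set. Then the MV-algebra McN(X) is residually finite if and only if the set of rational points of X (points all of whose coordinates are rational) is dense in X. (This is the concrete form, via Yosida duality, of the statement that a finitely generated MV-algebra is residually finite iff it is semisimple and its finite rank maximal ideals are dense in its maximal spectral space.) -/
open Set BigOperators

/-- The unit cube `[0,1]^n` as a subset of `Fin n → ℝ`. -/
def cube (n : ℕ) : Set (Fin n → ℝ) := Set.Icc 0 1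

/-- An (affine) linear polynomial with integer coefficients. -/
def IsAffineZ {n : ℕ} (p : (Fin n → ℝ) → ℝ) : Prop :=
  ∃ (m : ℤ) (c : Fin n → ℤ), ∀ x, p x = (m : ℝ) + ∑ i, (c i : ℝ) * x i

/-- A McNaughton function on `[0,1]^n`: continuous, `[0,1]`-valued, and agreeing at each
point of the cube with one of finitely many affine polynomials with integer coefficients. -/
def IsMcNaughton {n : ℕ} (f : (Fin n → ℝ) → ℝ) : Prop :=
  ContinuousOn f (cube n) ∧ (∀ x ∈ cube n, f x ∈ Set.Icc (0:ℝ) 1) ∧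
  ∃ (u : ℕ) (p : Fin u → (Fin n → ℝ) → ℝ),
    (∀ j, IsAffineZ (p j)) ∧ ∀ x ∈ cube n, ∃ j, f x = p j x

/-- `McN X`: restrictions to `X` of McNaughton functions on `[0,1]^n`. -/
def McN {n : ℕ} (X : Set (Fin n → ℝ)) : Set (↥X → ℝ) :=
  {g : ↥X → ℝ | ∃ f, IsMcNaughton (n := n) f ∧ ∀ x : X, g x = f x.1}

/-- Pointwise MV-negation `¬f = 1 - f`. -/
def mvNeg {α : Type*} (f : α → ℝ) : α → ℝ := fun x => 1 - f x

/-- Pointwise MV-sum `f ⊕ g = min(1, f + g)`. -/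
def mvOplus {α : Type*} (f g : α → ℝ) : α → ℝ := fun x => min 1 (f x + g x)

/-- A point all of whose coordinates are rational. -/
def IsRationalPoint {n : ℕ} (x : Fin n → ℝ) : Prop := ∀ i, ∃ q : ℚ, x i = (q : ℝ)

/-- An MV-endomorphism of `McN X`. -/
def IsMVEndo {n : ℕ} (X : Set (Fin n → ℝ)) (σ : (↥X → ℝ) → (↥X → ℝ)) : Prop :=
  Set.MapsTo σ (McN X) (McN X) ∧
  σ (fun _ => 0) = (fun _ => 0) ∧
  (∀ f ∈ McN X, σ (mvNeg f) = mvNeg (σ f)) ∧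
  (∀ f ∈ McN X, ∀ g ∈ McN X, σ (mvOplus f g) = mvOplus (σ f) (σ g))

/-- The finite MV-chain `C_d = {0, 1/d, …, 1}`. -/
def Cchain (d : ℕ) : Set ℝ := {y : ℝ | ∃ k : ℕ, k ≤ d ∧ y = (k : ℝ) / d}

/-- `McN X` is residually finite: distinct elements can be separated by a homomorphism
into some finite MV-chain `C_d`. -/
def ResiduallyFinite {n : ℕ} (X : Set (Fin n → ℝ)) : Prop :=
  ∀ f ∈ McN X, ∀ g ∈ McN X, f ≠ g →
    ∃ d : ℕ, 1 ≤ d ∧ ∃ σ : (↥X → ℝ) → ℝ,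
      (∀ h ∈ McN X, σ h ∈ Cchain d) ∧
      σ (fun _ => 0) = 0 ∧
      (∀ h ∈ McN X, σ (mvNeg h) = 1 - σ h) ∧
      (∀ h ∈ McN X, ∀ k ∈ McN X, σ (mvOplus h k) = min 1 (σ h + σ k)) ∧
      σ f ≠ σ g

/-- Truncation of a real number to the unit interval. -/
noncomputable def unitClamp (t : ℝ) : ℝ := max 0 (min 1 t)

/-- The functions obtained from `0` and the coordinate projections by the MV-operations. -/
inductive IsMVTerm {n : ℕ} : ((Fin n → ℝ) → ℝ) → Prop
  | zero : IsMVTerm (fun _ => 0)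
  | proj (i : Fin n) : IsMVTerm (fun x => x i)
  | neg {f : (Fin n → ℝ) → ℝ} : IsMVTerm f → IsMVTerm (mvNeg f)
  | oplus {f g : (Fin n → ℝ) → ℝ} : IsMVTerm f → IsMVTerm g → IsMVTerm (mvOplus f g)

lemma IsMcNaughton.of_finite {n : ℕ} {ι : Type*} [Finite ι] {f : (Fin n → ℝ) → ℝ}
    (hc : ContinuousOn f (cube n)) (hr : ∀ x ∈ cube n, f x ∈ Set.Icc (0 : ℝ) 1)
    (p : ι → (Fin n → ℝ) → ℝ) (hp : ∀ j, IsAffineZ (p j))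
    (hf : ∀ x ∈ cube n, ∃ j, f x = p j x) : IsMcNaughton f := by
  obtain ⟨u, ⟨e⟩⟩ := Finite.exists_equiv_fin ι
  refine ⟨hc, hr, u, fun j => p (e.symm j), fun j => hp _, fun x hx => ?_⟩
  obtain ⟨j, hj⟩ := hf x hx
  exact ⟨e j, by simpa using hj⟩

lemma isAffineZ_const {n : ℕ} (m : ℤ) : IsAffineZ (fun _ : Fin n → ℝ => (m : ℝ)) :=
  ⟨m, 0, fun x => by simp⟩

lemma isAffineZ_proj {n : ℕ} (i : Fin n) : IsAffineZ (fun x : Fin n → ℝ => x i) :=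
  ⟨0, Pi.single i 1, fun x => by simp [Pi.single_apply]⟩

lemma IsAffineZ.neg {n : ℕ} {p : (Fin n → ℝ) → ℝ} (hp : IsAffineZ p) :
    IsAffineZ (mvNeg p) := by
  obtain ⟨m, c, h⟩ := hp
  refine ⟨1 - m, -c, fun x => ?_⟩
  simp only [mvNeg, h, Pi.neg_apply, Int.cast_neg, neg_mul, Finset.sum_neg_distrib]
  push_cast
  ring

lemma IsAffineZ.add {n : ℕ} {p q : (Fin n → ℝ) → ℝ} (hp : IsAffineZ p) (hq : IsAffineZ q) :
    IsAffineZ (fun x => p x + q x) := by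
  obtain ⟨m, c, h⟩ := hp
  obtain ⟨m', c', h'⟩ := hq
  refine ⟨m + m', c + c', fun x => ?_⟩
  simp only [h, h', Pi.add_apply, Int.cast_add, add_mul, Finset.sum_add_distrib]
  ring

lemma IsMcNaughton.neg {n : ℕ} {f : (Fin n → ℝ) → ℝ} (hf : IsMcNaughton f) :
    IsMcNaughton (mvNeg f) := by
  obtain ⟨hc, hr, u, p, hp, h⟩ := hf
  refine ⟨continuousOn_const.sub hc, fun x hx => ?_, u, fun j => mvNeg (p j),
    fun j => (hp j).neg, fun x hx => ?_⟩
  · have := hr x hx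
    simp only [mvNeg, Set.mem_Icc] at this ⊢
    constructor <;> linarith
  · obtain ⟨j, hj⟩ := h x hx
    exact ⟨j, by simp [mvNeg, hj]⟩

lemma IsMcNaughton.oplus {n : ℕ} {f g : (Fin n → ℝ) → ℝ} (hf : IsMcNaughton f)
    (hg : IsMcNaughton g) : IsMcNaughton (mvOplus f g) := by
  obtain ⟨hc, hr, u, p, hp, h⟩ := hf
  obtain ⟨hc', hr', v, q, hq, h'⟩ := hg
  refine IsMcNaughton.of_finite (ι := Option (Fin u × Fin v))
    (continuousOn_const.inf (hc.add hc')) (fun x hx => ?_)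
    (fun j => j.elim (fun _ => ((1 : ℤ) : ℝ)) (fun k x => p k.1 x + q k.2 x)) ?_
    (fun x hx => ?_)
  · exact ⟨le_min zero_le_one (add_nonneg (hr x hx).1 (hr' x hx).1), min_le_left _ _⟩
  · rintro (_ | k)
    · exact isAffineZ_const 1
    · exact (hp k.1).add (hq k.2)
  · obtain ⟨j, hj⟩ := h x hx
    obtain ⟨k, hk⟩ := h' x hx
    rcases min_choice (1 : ℝ) (f x + g x) with h1 | h1
    · exact ⟨none, by simpa [mvOplus] using h1⟩
    · exact ⟨some (j, k), by simpa [mvOplus, hj, hk] using h1⟩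

lemma IsMVTerm.isMcNaughton {n : ℕ} {f : (Fin n → ℝ) → ℝ} (hf : IsMVTerm f) :
    IsMcNaughton f := by
  induction hf with
  | zero =>
    exact IsMcNaughton.of_finite (ι := Unit) continuousOn_const (fun x _ => by simp)
      (fun _ _ => ((0 : ℤ) : ℝ)) (fun _ => isAffineZ_const 0) (fun x _ => by simp)
  | proj i =>
    exact IsMcNaughton.of_finite (ι := Unit) (continuous_apply i).continuousOn
      (fun x hx => ⟨hx.1 i, hx.2 i⟩) (fun _ x => x i) (fun _ => isAffineZ_proj i)
      (fun x _ => ⟨(), rfl⟩)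
  | neg _ ih => exact ih.neg
  | oplus _ _ ihf ihg => exact ihf.oplus ihg

lemma IsMcNaughton.domRestrict_mem {n : ℕ} {f : (Fin n → ℝ) → ℝ} (hf : IsMcNaughton f)
    (X : Set (Fin n → ℝ)) : X.domRestrict f ∈ McN X :=
  ⟨f, hf, fun _ => rfl⟩

/-- A map respecting the MV-operations acts on MV-terms as evaluation at the image of the
coordinate projections. -/
lemma IsMVTerm.map_eq_eval {n : ℕ} {X : Set (Fin n → ℝ)} {σ : (↥X → ℝ) → ℝ}
    (h0 : σ (fun _ => 0) = 0) (hneg : ∀ h ∈ McN X, σ (mvNeg h) = 1 - σ h)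
    (hadd : ∀ h ∈ McN X, ∀ k ∈ McN X, σ (mvOplus h k) = min 1 (σ h + σ k))
    {f : (Fin n → ℝ) → ℝ} (hf : IsMVTerm f) :
    σ (X.domRestrict f) = f (fun i => σ (X.domRestrict fun x => x i)) := by
  induction hf with
  | zero => exact h0
  | proj i => rfl
  | @neg f hf ih =>
    simp only [mvNeg, ← ih]
    exact hneg _ (hf.isMcNaughton.domRestrict_mem X)
  | @oplus f g hf hg ihf ihg =>
    simp only [mvOplus, ← ihf, ← ihg]
    exact hadd _ (hf.isMcNaughton.domRestrict_mem X) _ (hg.isMcNaughton.domRestrict_mem X)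

lemma unitClamp_add {p x : ℝ} (h0 : 0 ≤ x) (h1 : x ≤ 1) :
    unitClamp (p + x) =
      1 - min 1 ((1 - min 1 (unitClamp p + x)) + (1 - unitClamp (p + 1))) := by
  unfold unitClamp
  grind

lemma exists_isMVTerm_unitClamp {n : ℕ} (i : Fin n) (M : ℕ) (a : ℤ) :
    ∃ f, IsMVTerm f ∧ ∀ x ∈ cube n, f x = unitClamp (M * x i - a) := by
  induction M generalizing a with
  | zero =>
    rcases le_or_gt 0 a with ha | ha
    · refine ⟨_, .zero, fun x _ => ?_⟩
      have : (0 : ℝ) ≤ a := by exact_mod_cast ha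
      simp [unitClamp, this]
    · refine ⟨_, .neg .zero, fun x _ => ?_⟩
      have : (a : ℝ) ≤ -1 := by exact_mod_cast (by omega : a ≤ -1)
      simp only [mvNeg, unitClamp]
      grind
  | succ M ih =>
    obtain ⟨f, hf, hfx⟩ := ih a
    obtain ⟨g, hg, hgx⟩ := ih (a - 1)
    refine ⟨_, .neg (.oplus (.neg (.oplus hf (.proj i))) (.neg hg)), fun x hx => ?_⟩
    have key := unitClamp_add (p := M * x i - a) (hx.1 i) (hx.2 i)
    simp only [mvNeg, mvOplus, hfx x hx, hgx x hx]
    push_cast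
    rw [show ((M : ℝ) + 1) * x i - a = M * x i - a + x i by ring, key,
      show (M : ℝ) * x i - (a - 1) = M * x i - a + 1 by ring]

/-- There is an MV-term vanishing exactly on the common zero set of the `M * x i - a i` and
equal to `1` exactly where one of these is at least `1` in absolute value. -/
lemma exists_isMVTerm_box {n : ℕ} (M : ℕ) (a : Fin n → ℤ) :
    ∃ f, IsMVTerm f ∧ ∀ x ∈ cube n, (f x = 0 ↔ ∀ i, (M : ℝ) * x i = a i) ∧
      (f x = 1 ↔ ∃ i, 1 ≤ |(M : ℝ) * x i - a i|) := by
  suffices H : ∀ s : Finset (Fin n), ∃ f, IsMVTerm f ∧ ∀ x ∈ cube n,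
      (f x = 0 ↔ ∀ i ∈ s, (M : ℝ) * x i = a i) ∧
      (f x = 1 ↔ ∃ i ∈ s, 1 ≤ |(M : ℝ) * x i - a i|) by
    simpa using H Finset.univ
  intro s
  induction s using Finset.induction_on with
  | empty => exact ⟨_, .zero, fun x _ => by simp⟩
  | insert i s _ ih =>
    obtain ⟨f, hf, hfx⟩ := ih
    obtain ⟨g, hg, hgx⟩ := exists_isMVTerm_unitClamp i M (a i)
    obtain ⟨k, hk, hkx⟩ := exists_isMVTerm_unitClamp i M (a i - 1)
    have hb := IsMVTerm.oplus hg (.neg hk)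
    refine ⟨_, .oplus (.neg (.oplus (.neg hf) hb)) hb, fun x hx => ?_⟩
    have hr := hf.isMcNaughton.2.1 x hx
    have habs : mvOplus g (mvNeg k) x = min 1 |(M : ℝ) * x i - a i| := by
      simp only [mvOplus, mvNeg, hgx x hx, hkx x hx, unitClamp]
      push_cast
      grind
    have hmax : mvOplus (mvNeg (mvOplus (mvNeg f) (mvOplus g (mvNeg k))))
        (mvOplus g (mvNeg k)) x = max (f x) (min 1 |(M : ℝ) * x i - a i|) := by
      rw [← habs]
      have h1 : mvOplus g (mvNeg k) x ≤ 1 := min_le_left _ _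
      have h2 : 0 ≤ mvOplus g (mvNeg k) x := (hb.isMcNaughton.2.1 x hx).1
      generalize mvOplus g (mvNeg k) = b at h1 h2
      simp only [mvOplus, mvNeg]
      grind
    rw [hmax, Finset.forall_mem_insert, Finset.exists_mem_insert, ← (hfx x hx).1,
      ← (hfx x hx).2, ← sub_eq_zero (a := (M : ℝ) * x i), ← abs_eq_zero (a := (M : ℝ) * x i - a i)]
    have := abs_nonneg ((M : ℝ) * x i - a i)
    obtain ⟨h0, h1⟩ := hr
    constructor <;> grind

lemma IsRationalPoint.exists_common_denom {n : ℕ} {x : Fin n → ℝ} (hx : IsRationalPoint x) :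
    ∃ d : ℕ, 1 ≤ d ∧ ∀ i, ∃ z : ℤ, (d : ℝ) * x i = z := by
  choose q hq using hx
  refine ⟨∏ i, (q i).den, Finset.prod_pos fun i _ => (q i).pos, fun i => ?_⟩
  obtain ⟨e, he⟩ := Finset.dvd_prod_of_mem (fun i => (q i).den) (Finset.mem_univ i)
  refine ⟨e * (q i).num, ?_⟩
  have h : ((q i).den : ℝ) * (q i : ℝ) = (q i).num := by exact_mod_cast (q i).den_mul_eq_num
  rw [he, hq]
  push_cast
  rw [← h]
  ring

lemma IsMcNaughton.mem_Cchain {n : ℕ} {f : (Fin n → ℝ) → ℝ} (hf : IsMcNaughton f)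
    {x : Fin n → ℝ} (hx : x ∈ cube n) {d : ℕ} (hd : 1 ≤ d)
    (hdx : ∀ i, ∃ z : ℤ, (d : ℝ) * x i = z) : f x ∈ Cchain d := by
  obtain ⟨-, hr, u, p, hp, h⟩ := hf
  obtain ⟨j, hj⟩ := h x hx
  obtain ⟨m, c, hpj⟩ := hp j
  obtain ⟨h0, h1⟩ := hr x hx
  choose z hz using hdx
  have hd' : (0 : ℝ) < d := by exact_mod_cast hd
  have hw : (d : ℝ) * f x = ((d * m + ∑ i, c i * z i : ℤ) : ℝ) := by
    rw [hj, hpj]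
    push_cast
    rw [mul_add, Finset.mul_sum]
    congr 1
    refine Finset.sum_congr rfl fun i _ => ?_
    rw [← hz]
    ring
  obtain ⟨w, hw'⟩ : ∃ w : ℤ, (d : ℝ) * f x = w := ⟨_, hw⟩
  have hw0 : 0 ≤ w := by
    have : (0 : ℝ) ≤ w := hw' ▸ mul_nonneg hd'.le h0
    exact_mod_cast this
  lift w to ℕ using hw0
  refine ⟨w, ?_, ?_⟩
  · have : ((w : ℤ) : ℝ) ≤ d := hw' ▸ mul_le_of_le_one_right hd'.le h1
    exact_mod_cast this
  · rw [eq_div_iff hd'.ne', mul_comm, hw']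
    simp

lemma residuallyFinite_of_subset_closure {n : ℕ} {X : Set (Fin n → ℝ)} (hXc : X ⊆ cube n)
    (hX : X ⊆ closure {x ∈ X | IsRationalPoint x}) : ResiduallyFinite X := by
  rintro f ⟨F, hF, hfF⟩ g ⟨G, hG, hgG⟩ hne
  obtain ⟨x, ⟨hxX, hxr⟩, hx⟩ : ∃ x ∈ {x ∈ X | IsRationalPoint x}, F x ≠ G x := by
    by_contra! H
    have hEq := Set.EqOn.of_subset_closure (f := F) (g := G) H (hF.1.mono hXc)
      (hG.1.mono hXc) (Set.sep_subset _ _) hX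
    exact hne (funext fun x => by rw [hfF, hgG, hEq x.2])
  obtain ⟨d, hd, hdx⟩ := hxr.exists_common_denom
  refine ⟨d, hd, fun h => h ⟨x, hxX⟩, ?_, rfl, fun _ _ => rfl, fun _ _ _ _ => rfl, ?_⟩
  · rintro h ⟨H, hH, hhH⟩
    simpa only [hhH] using hH.mem_Cchain (hXc hxX) hd hdx
  · simpa only [hfF, hgG] using hx

/-- The point of the cube determined by a homomorphism from `McN X` to a finite chain lies
in `X`. -/
lemma eval_point_mem {n : ℕ} {X : Set (Fin n → ℝ)} (hXc : X ⊆ cube n) (hcl : IsClosed X)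
    {σ : (↥X → ℝ) → ℝ} (h0 : σ (fun _ => 0) = 0)
    (hneg : ∀ h ∈ McN X, σ (mvNeg h) = 1 - σ h)
    (hadd : ∀ h ∈ McN X, ∀ k ∈ McN X, σ (mvOplus h k) = min 1 (σ h + σ k))
    (hcube : (fun i => σ (X.domRestrict fun x => x i)) ∈ cube n)
    (hrat : IsRationalPoint fun i => σ (X.domRestrict fun x => x i)) :
    (fun i => σ (X.domRestrict fun x => x i)) ∈ X := by
  by_contra hyX
  have heval := fun f (hf : IsMVTerm f) => hf.map_eq_eval h0 hneg hadd
  generalize (fun i => σ (X.domRestrict fun x => x i)) = y at *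
  obtain ⟨δ, hδ, hball⟩ := Metric.isOpen_iff.1 hcl.isOpen_compl y hyX
  obtain ⟨d, hd, hdy⟩ := hrat.exists_common_denom
  choose z hz using hdy
  obtain ⟨N, hN⟩ := exists_nat_ge (1 / δ)
  have hd' : (1 : ℝ) ≤ d := by exact_mod_cast hd
  have hNd : ∀ i, ((N * d : ℕ) : ℝ) * y i = ((N * z i : ℤ) : ℝ) := fun i => by
    push_cast
    rw [mul_assoc, hz]
  obtain ⟨f, hf, hfx⟩ := exists_isMVTerm_box (N * d) fun i => N * z i
  have hfy : f y = 0 := (hfx y hcube).1.2 hNd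
  have hfX : X.domRestrict f = mvNeg (fun _ => 0) := by
    funext x
    have hx : f x = 1 := by
      refine (hfx x (hXc x.2)).2.2 ?_
      by_contra! H
      refine hball ((dist_pi_lt_iff hδ).2 fun i => ?_) x.2
      have hi := H i
      rw [← hNd, ← mul_sub, abs_mul, Nat.abs_cast, ← Real.dist_eq] at hi
      by_contra! hle
      have h1 : 1 ≤ (N : ℝ) * δ := (div_le_iff₀ hδ).1 hN
      push_cast at hi
      have h2 : (N : ℝ) * δ ≤ N * dist ((x : Fin n → ℝ) i) (y i) := by gcongr
      have h3 : (N : ℝ) * dist ((x : Fin n → ℝ) i) (y i) ≤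
          N * d * dist ((x : Fin n → ℝ) i) (y i) := by
        gcongr
        exact le_mul_of_one_le_right (Nat.cast_nonneg N) hd'
      linarith
    simp [mvNeg, hx]
  have h1 := heval f hf
  rw [hfX, hneg _ ⟨_, IsMVTerm.zero.isMcNaughton, fun _ => rfl⟩, h0, hfy] at h1
  norm_num at h1

lemma ResiduallyFinite.subset_closure {n : ℕ} {X : Set (Fin n → ℝ)} (hXc : X ⊆ cube n)
    (hcl : IsClosed X) (hX : ResiduallyFinite X) :
    X ⊆ closure {x ∈ X | IsRationalPoint x} := by
  intro x₀ hx₀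
  rw [Metric.mem_closure_iff]
  intro ε hε
  obtain ⟨M, hM⟩ := exists_nat_gt (2 / ε)
  have hM0 : (0 : ℝ) < M := (by positivity : 0 < 2 / ε).trans hM
  obtain ⟨f, hf, hfx⟩ := exists_isMVTerm_box M fun i => ⌊(M : ℝ) * x₀ i⌋
  have hfrac : ∀ i, |(M : ℝ) * x₀ i - ⌊(M : ℝ) * x₀ i⌋| < 1 := fun i => by
    rw [Int.self_sub_floor, Int.abs_fract]
    exact Int.fract_lt_one _
  have hfx₀ : f x₀ ≠ 1 := fun h => by
    obtain ⟨i, hi⟩ := (hfx x₀ (hXc hx₀)).2.1 h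
    exact hi.not_gt (hfrac i)
  obtain ⟨d, hd, σ, hC, h0, hneg, hadd, hσ⟩ := hX _ (hf.neg.isMcNaughton.domRestrict_mem X)
    (fun _ => 0) ⟨_, IsMVTerm.zero.isMcNaughton, fun _ => rfl⟩ fun h => by
      have := congrFun h ⟨x₀, hx₀⟩
      simp only [Set.domRestrict_apply, mvNeg] at this
      exact hfx₀ (by linarith)
  rw [hf.neg.map_eq_eval h0 hneg hadd, h0] at hσ
  have hyC : ∀ i, σ (X.domRestrict fun x => x i) ∈ Cchain d := fun i =>
    hC _ ((IsMVTerm.proj i).isMcNaughton.domRestrict_mem X)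
  have hd' : (0 : ℝ) < d := by exact_mod_cast hd
  have hcube : (fun i => σ (X.domRestrict fun x => x i)) ∈ cube n := by
    constructor <;> intro i <;> obtain ⟨k, hk, h⟩ := hyC i <;> simp only [h]
    · exact div_nonneg (Nat.cast_nonneg k) hd'.le
    · exact (div_le_one hd').2 (by exact_mod_cast hk)
  have hrat : IsRationalPoint fun i => σ (X.domRestrict fun x => x i) := fun i => by
    obtain ⟨k, -, h⟩ := hyC i
    exact ⟨k / d, by simp [h]⟩
  refine ⟨_, ⟨eval_point_mem hXc hcl h0 hneg hadd hcube hrat, hrat⟩,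
    (dist_pi_lt_iff hε).2 fun i => ?_⟩
  have hy : |(M : ℝ) * σ (X.domRestrict fun x => x i) - ⌊(M : ℝ) * x₀ i⌋| < 1 := by
    by_contra! hle
    refine hσ ?_
    rw [mvNeg, (hfx _ hcube).2.2 ⟨i, hle⟩, sub_self]
  have h2 : (M : ℝ) * dist (x₀ i) (σ (X.domRestrict fun x => x i)) < 2 := by
    rw [Real.dist_eq, ← abs_of_pos hM0, ← abs_mul, mul_sub]
    have := hfrac i
    rw [abs_lt] at *
    constructor <;> linarith
  have h3 : 2 < (M : ℝ) * ε := (div_lt_iff₀ hε).1 hM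
  exact lt_of_mul_lt_mul_left (h2.trans h3) hM0.le


/-- for a nonempty closed `X ⊆ [0,1]^n`, the MV-algebra `McN(X)` is residually
finite iff the rational points of `X` are dense in `X`. -/
theorem stmt0 {n : ℕ} (hn : 1 ≤ n) (X : Set (Fin n → ℝ)) (hXc : X ⊆ cube n)
    (hcl : IsClosed X) (hne : X.Nonempty) :
    ResiduallyFinite X ↔ X ⊆ closure {x ∈ X | IsRationalPoint x} :=
  ⟨fun h => h.subset_closure hXc hcl, residuallyFinite_of_subset_closure hXc⟩
end

section
/- Let n ≥ 1 and let π_1, …, π_n : [0,1]^n → ℝ be the coordinate functions. Then: (a) M_n is generated by π_1, …, π_n together with the constant function 1, i.e., the smallest subgroup of M_n containing π_1, …, π_n and 1 and closed under ∨ and ∧ is all of M_n; (b) for every unital ℓ-group (H, v) and every n-tuple v_1, …, v_n of elements of H with 0 ≤ v_i ≤ v, there is a unique unital ℓ-homomorphism η : (M_n, 1) → (H, v) with η(π_i) = v_i for i = 1, …, n. -/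
open Set BigOperators

/-- An element of `M_n`: a continuous real-valued function on `[0,1]^n` that agrees at each
point of the cube with one of finitely many affine polynomials with integer coefficients. -/
def IsPWLZ {n : ℕ} (f : (Fin n → ℝ) → ℝ) : Prop :=
  ContinuousOn f (cube n) ∧
  ∃ (u : ℕ) (p : Fin u → (Fin n → ℝ) → ℝ),
    (∀ j, IsAffineZ (p j)) ∧ ∀ x ∈ cube n, ∃ j, f x = p j x

/-- `Mres X = M_n↾X`: restrictions to `X` of elements of `M_n`. -/
def Mres {n : ℕ} (X : Set (Fin n → ℝ)) : Set (↥X → ℝ) :=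
  {g : ↥X → ℝ | ∃ f, IsPWLZ (n := n) f ∧ ∀ x : X, g x = f x.1}

/-- A unital ℓ-endomorphism of `(M_n↾X, 1)`: preserves `+`, `⊔`, `⊓` (pointwise) and the
unit (the constant function `1`). -/
def IsUnitalLEndo {n : ℕ} (X : Set (Fin n → ℝ)) (σ : (↥X → ℝ) → (↥X → ℝ)) : Prop :=
  Set.MapsTo σ (Mres X) (Mres X) ∧
  (∀ f ∈ Mres X, ∀ g ∈ Mres X, σ (f + g) = σ f + σ g) ∧
  (∀ f ∈ Mres X, ∀ g ∈ Mres X, σ (f ⊔ g) = σ f ⊔ σ g) ∧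
  (∀ f ∈ Mres X, ∀ g ∈ Mres X, σ (f ⊓ g) = σ f ⊓ σ g) ∧
  σ 1 = 1

/-- `η` is a unital ℓ-homomorphism from `(M_n, 1)` (realized as `Mres (cube n)`) to the
unital ℓ-group `(H, v)` sending the `i`-th coordinate function `π_i` to `vs i`. -/
def UnitalHomOn (n : ℕ) (H : Type*) [AddCommGroup H] [Lattice H] (v : H) (vs : Fin n → H)
    (η : (↥(cube n) → ℝ) → H) : Prop :=
  (∀ f ∈ Mres (cube n), ∀ g ∈ Mres (cube n), η (f + g) = η f + η g) ∧
  (∀ f ∈ Mres (cube n), ∀ g ∈ Mres (cube n), η (f ⊔ g) = η f ⊔ η g) ∧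
  (∀ f ∈ Mres (cube n), ∀ g ∈ Mres (cube n), η (f ⊓ g) = η f ⊓ η g) ∧
  η 1 = v ∧ ∀ i, η (fun x => x.1 i) = vs i

section LatticeGroup

variable {H : Type*} [AddCommGroup H] [Lattice H] [IsOrderedAddMonoid H]

theorem inf_add_eq_zero {a b c : H} (ha : 0 ≤ a) (hb : 0 ≤ b) (hc : 0 ≤ c)
    (hab : a ⊓ b = 0) (hac : a ⊓ c = 0) : a ⊓ (b + c) = 0 := by
  refine le_antisymm ?_ (le_inf ha (add_nonneg hb hc))
  have h : a ⊓ (b + c) ≤ c := by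
    calc a ⊓ (b + c) ≤ (a + c) ⊓ (b + c) := inf_le_inf_right _ (le_add_of_nonneg_right hc)
      _ = a ⊓ b + c := (inf_add a b c).symm
      _ = c := by rw [hab, zero_add]
  exact hac ▸ le_inf inf_le_left h

theorem inf_nsmul_eq_zero {a b : H} (ha : 0 ≤ a) (hb : 0 ≤ b) (hab : a ⊓ b = 0) (k : ℕ) :
    a ⊓ k • b = 0 := by
  induction k with
  | zero => simpa using ha
  | succ k ih =>
    rw [succ_nsmul]
    exact inf_add_eq_zero ha (nsmul_nonneg hb k) hb ih hab

theorem nonneg_of_nsmul_nonneg {w : H} {k : ℕ} (hk : 0 < k) (h : 0 ≤ k • w) : 0 ≤ w := by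
  have hle : k • w⁻ ≤ k • w⁺ := by
    rw [← sub_nonneg, ← nsmul_sub, posPart_sub_negPart]
    exact h
  have hdisj : w⁻ ⊓ k • w⁺ = 0 :=
    inf_nsmul_eq_zero (negPart_nonneg w) (posPart_nonneg w)
      (by rw [inf_comm]; exact posPart_inf_negPart_eq_zero w) k
  have hself : w⁻ ≤ k • w⁻ := by
    simpa using nsmul_le_nsmul_left (negPart_nonneg w) (Nat.one_le_iff_ne_zero.2 hk.ne')
  have h0 : w⁻ = 0 := by rwa [inf_eq_left.2 (hself.trans hle)] at hdisj
  exact negPart_eq_zero.1 h0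

theorem nonneg_of_zsmul_nonneg {w : H} {k : ℤ} (hk : 0 < k) (h : 0 ≤ k • w) : 0 ≤ w := by
  lift k to ℕ using hk.le
  rw [natCast_zsmul] at h
  exact nonneg_of_nsmul_nonneg (by exact_mod_cast hk) h

/-- Farkas' lemma over `ℤ`, in the form of a transfer principle: an implication between
homogeneous linear inequalities valid in `ℤ` is valid in every abelian ℓ-group. -/
theorem transfer_linear_inequalities {R : Type*} [AddCommGroup R]
    (hsep : ∀ r : R, (∀ x : R →+ ℤ, x r = 0) → r = 0) (E : R →+ H) (L : List R) (g : R)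
    (hg : ∀ x : R →+ ℤ, (∀ f ∈ L, 0 ≤ x f) → 0 ≤ x g) (hL : ∀ f ∈ L, 0 ≤ E f) : 0 ≤ E g := by
  induction hn : L.length generalizing L g with
  | zero =>
    obtain rfl := List.length_eq_zero_iff.1 hn
    have : g = 0 := hsep g fun x ↦ le_antisymm
      (by simpa using hg (-x) (by simp)) (hg x (by simp))
    simp [this]
  | succ n ih =>
    obtain ⟨h, L, rfl⟩ := List.exists_cons_of_length_eq_add_one hn
    simp only [List.length_cons, Nat.add_right_cancel_iff] at hn
    simp only [List.forall_mem_cons] at hg hL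
    by_cases hgL : ∀ x : R →+ ℤ, (∀ f ∈ L, 0 ≤ x f) → 0 ≤ x g
    · exact ih L g hgL hL.2 hn
    push Not at hgL
    obtain ⟨y, hyL, hyg⟩ := hgL
    have hyh : y h < 0 := by
      by_contra! hyh
      exact hyg.not_ge (hg y ⟨hyh, hyL⟩)
    have key : 0 ≤ E ((-y h) • g + y g • h) := by
      refine ih (L.map fun f ↦ (-y h) • f + y f • h) _ ?_ ?_ (by simpa using hn)
      · intro x hx
        simp only [List.forall_mem_map, map_add, map_zsmul, smul_eq_mul] at hx ⊢
        have := hg ((-y h) • x + x h • y) ⟨by simp [mul_comm], fun f hf ↦ by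
          have := hx f hf
          simp only [AddMonoidHom.add_apply, AddMonoidHom.smul_apply, smul_eq_mul]
          linarith [mul_comm (y f) (x h)]⟩
        simp only [AddMonoidHom.add_apply, AddMonoidHom.smul_apply, smul_eq_mul] at this
        linarith [mul_comm (y g) (x h)]
      · simp only [List.forall_mem_map, map_add, map_zsmul]
        exact fun f hf ↦ add_nonneg (zsmul_nonneg (hL.2 f hf) (by omega))
          (zsmul_nonneg hL.1 (hyL f hf))
    refine nonneg_of_zsmul_nonneg (k := -y h) (by omega) ?_
    have hsum : (-y h) • E g = E ((-y h) • g + y g • h) + (-y g) • E h := by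
      simp only [map_add, map_neg, map_zsmul, neg_smul]
      abel
    rw [hsum]
    exact add_nonneg key (zsmul_nonneg hL.1 (by omega))

end LatticeGroup

section Segment

theorem exists_line_separating_zero {κ : Type*} [Finite κ] {h : ℝ → ℝ}
    (hc : ContinuousOn h (Icc 0 1)) (a b : κ → ℝ)
    (hab : ∀ t ∈ Icc (0 : ℝ) 1, ∃ k, h t = a k + b k * t) (h0 : h 0 ≤ 0) (h1 : h 1 = 0) :
    ∃ k, a k ≤ 0 ∧ 0 ≤ a k + b k := by
  have line_cont : ∀ k, Continuous fun t ↦ a k + b k * t := fun k ↦ by fun_prop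
  by_cases hfr : ∃ᶠ t in nhdsWithin 1 (Iio (1 : ℝ)), h t ≤ 0
  · have hfr' : ∃ᶠ t in nhdsWithin 1 (Iio (1 : ℝ)),
        ∃ k, h t = a k + b k * t ∧ h t ≤ 0 ∧ 0 < t ∧ t < 1 := by
      refine (hfr.and_eventually (Ioo_mem_nhdsLT zero_lt_one)).mono fun t ⟨ht, ht'⟩ ↦ ?_
      obtain ⟨k, hk⟩ := hab t ⟨ht'.1.le, ht'.2.le⟩
      exact ⟨k, hk, ht, ht'.1, ht'.2⟩
    obtain ⟨k, hk⟩ := Filter.frequently_exists.1 hfr'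
    have hlim : Filter.Tendsto h (nhdsWithin 1 (Iio (1 : ℝ))) (nhds (h 1)) :=
      (hc 1 (by simp)).tendsto.mono_left (nhdsWithin_le_of_mem (Icc_mem_nhdsLT zero_lt_one))
    have heq := tendsto_nhds_unique_of_frequently_eq hlim
      ((line_cont k).continuousWithinAt (s := Iio 1) (x := 1)).tendsto (hk.mono fun t ht ↦ ht.1)
    obtain ⟨t, ht, ht', ht0, ht1⟩ := hk.exists
    refine ⟨k, ?_, by linarith⟩
    have : 0 ≤ b k := by
      by_contra! hb
      nlinarith
    nlinarith
  · simp only [Filter.not_frequently, not_le] at hfr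
    obtain ⟨l, hl, hlpos⟩ := (mem_nhdsLT_iff_exists_Ioo_subset' (zero_lt_one (α := ℝ))).1 hfr
    simp only [mem_Iio] at hl
    set m := (max l 0 + 1) / 2
    have hm0 : 0 ≤ m := by have := le_max_right l 0; simp only [m]; linarith
    have hm1 : m < 1 := by have := max_lt hl zero_lt_one; simp only [m]; linarith
    have hlm : l < m := by
      have := max_lt hl zero_lt_one
      have := le_max_left l 0
      simp only [m]; linarith
    have hcomp : IsCompact (Icc 0 m ∩ h ⁻¹' Iic 0) :=
      isCompact_Icc.of_isClosed_subset
        ((hc.mono (Icc_subset_Icc_right hm1.le)).preimage_isClosed_of_isClosed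
          isClosed_Icc isClosed_Iic)
        inter_subset_left
    obtain ⟨s, ⟨⟨hs0, hsm⟩, hs⟩, hmax⟩ := hcomp.exists_isGreatest ⟨0, ⟨le_rfl, hm0⟩, h0⟩
    have hpos : ∀ t ∈ Ioo s 1, 0 < h t := by
      intro t ht
      by_contra! hneg
      by_cases htm : t ≤ m
      · exact ht.1.not_ge (hmax ⟨⟨hs0.trans ht.1.le, htm⟩, hneg⟩)
      · exact hneg.not_gt (hlpos ⟨hlm.trans (not_le.1 htm), ht.2⟩)
    have hs1 : s < 1 := hsm.trans_lt hm1
    have hfr' : ∃ᶠ t in nhdsWithin s (Ioi s),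
        ∃ k, h t = a k + b k * t ∧ 0 < h t ∧ s < t ∧ t < 1 := by
      refine Filter.Eventually.frequently ?_
      filter_upwards [Ioo_mem_nhdsGT hs1] with t ht
      obtain ⟨k, hk⟩ := hab t ⟨hs0.trans ht.1.le, ht.2.le⟩
      exact ⟨k, hk, hpos t ht, ht.1, ht.2⟩
    obtain ⟨k, hk⟩ := Filter.frequently_exists.1 hfr'
    have hlim : Filter.Tendsto h (nhdsWithin s (Ioi s)) (nhds (h s)) :=
      (hc s ⟨hs0, hs1.le⟩).tendsto.mono_left (nhdsWithin_le_of_mem (Filter.mem_of_superset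
        (Ioo_mem_nhdsGT hs1) fun t ht ↦ ⟨hs0.trans ht.1.le, ht.2.le⟩))
    have heq := tendsto_nhds_unique_of_frequently_eq hlim
      ((line_cont k).continuousWithinAt (s := Ioi s) (x := s)).tendsto (hk.mono fun t ht ↦ ht.1)
    obtain ⟨t, ht, htp, hst, ht1⟩ := hk.exists
    simp only [mem_preimage, mem_Iic] at hs
    have : 0 < b k := by
      by_contra! hb
      nlinarith
    exact ⟨k, by nlinarith, by nlinarith⟩

theorem exists_line_separating {κ : Type*} [Finite κ] {g : ℝ → ℝ}
    (hc : ContinuousOn g (Icc 0 1)) (a b : κ → ℝ)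
    (hab : ∀ t ∈ Icc (0 : ℝ) 1, ∃ k, g t = a k + b k * t) :
    ∃ k, a k ≤ g 0 ∧ g 1 ≤ a k + b k := by
  obtain ⟨k, hk0, hk1⟩ := exists_line_separating_zero
    (h := fun t ↦ g t - (g 0 + (g 1 - g 0) * t)) (hc.sub (by fun_prop))
    (fun k ↦ a k - g 0) (fun k ↦ b k - (g 1 - g 0))
    (fun t ht ↦ by
      obtain ⟨k, hk⟩ := hab t ht
      exact ⟨k, by rw [hk]; ring⟩) (by simp) (by simp)
  exact ⟨k, by linarith, by linarith⟩

end Segment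

section Affine

variable {n : ℕ}

/-- The homomorphism sending the coefficients `(m, c)` of an integer affine polynomial to its
value `m • u + ∑ i, c i • w i`. -/
def affineHom {M : Type*} [AddCommGroup M] (u : M) (w : Fin n → M) :
    ℤ × (Fin n → ℤ) →+ M where
  toFun p := p.1 • u + ∑ i, p.2 i • w i
  map_zero' := by simp
  map_add' p q := by
    simp only [Prod.fst_add, Prod.snd_add, Pi.add_apply, add_smul, Finset.sum_add_distrib]
    abel

theorem affineHom_apply {M : Type*} [AddCommGroup M] (u : M) (w : Fin n → M)
    (p : ℤ × (Fin n → ℤ)) : affineHom u w p = p.1 • u + ∑ i, p.2 i • w i := rfl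

theorem affineHom_one_zero {M : Type*} [AddCommGroup M] (u : M) (w : Fin n → M) :
    affineHom u w (1, 0) = u := by
  simp [affineHom_apply]

theorem affineHom_zero_single {M : Type*} [AddCommGroup M] (u : M) (w : Fin n → M) (i : Fin n) :
    affineHom u w (0, Pi.single i 1) = w i := by
  simp [affineHom_apply, Pi.single_apply, ite_smul]

theorem map_affineHom {M N : Type*} [AddCommGroup M] [AddCommGroup N] (φ : M →+ N) (u : M)
    (w : Fin n → M) (p : ℤ × (Fin n → ℤ)) :
    φ (affineHom u w p) = affineHom (φ u) (fun i ↦ φ (w i)) p := by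
  simp [affineHom_apply]

theorem affineHom_coeff (p : ℤ × (Fin n → ℤ)) :
    affineHom (1, 0) (fun i ↦ ((0 : ℤ), (Pi.single i 1 : Fin n → ℤ))) p = p := by
  ext j
  · simp [affineHom_apply, Prod.fst_sum]
  · simp [affineHom_apply, Prod.snd_sum, Finset.sum_apply, Pi.single_apply]

theorem addMonoidHom_apply_eq_affineHom {M : Type*} [AddCommGroup M]
    (φ : ℤ × (Fin n → ℤ) →+ M) (p : ℤ × (Fin n → ℤ)) :
    φ p = affineHom (φ (1, 0)) (fun i ↦ φ (0, Pi.single i 1)) p := by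
  rw [← map_affineHom, affineHom_coeff]

/-- The coordinate functions on the cube. -/
def coordFun (i : Fin n) : ↥(cube n) → ℝ := fun x ↦ x.1 i

/-- The restriction to the cube of the integer affine polynomial with given coefficients. -/
def affineFun : ℤ × (Fin n → ℤ) →+ (↥(cube n) → ℝ) := affineHom 1 coordFun

theorem affineFun_apply (p : ℤ × (Fin n → ℤ)) (x : ↥(cube n)) :
    affineFun p x = p.1 + ∑ i, (p.2 i : ℝ) * x.1 i := by
  simp [affineFun, affineHom_apply, coordFun]

theorem continuous_affineFun (p : ℤ × (Fin n → ℤ)) : Continuous (affineFun p) := by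
  have : affineFun p = fun x : ↥(cube n) ↦ p.1 + ∑ i, (p.2 i : ℝ) * x.1 i :=
    funext (affineFun_apply p)
  rw [this]
  exact continuous_const.add (continuous_finsetSum _ fun i _ ↦
    continuous_const.mul ((continuous_apply i).comp continuous_subtype_val))

theorem zero_mem_cube : (0 : Fin n → ℝ) ∈ cube n := ⟨le_rfl, zero_le_one⟩

theorem mem_Mres_cube_iff {g : ↥(cube n) → ℝ} :
    g ∈ Mres (cube n) ↔
      Continuous g ∧ ∃ P : Finset (ℤ × (Fin n → ℤ)), ∀ x, ∃ p ∈ P, g x = affineFun p x := by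
  classical
  constructor
  · rintro ⟨f, ⟨hfc, u, p, hp, hfp⟩, hgf⟩
    obtain rfl : g = (cube n).domRestrict f := funext hgf
    refine ⟨continuousOn_iff_continuous_domRestrict.1 hfc, ?_⟩
    choose m c hmc using hp
    refine ⟨Finset.univ.image fun j ↦ (m j, c j), fun x ↦ ?_⟩
    obtain ⟨j, hj⟩ := hfp x.1 x.2
    exact ⟨(m j, c j), Finset.mem_image_of_mem _ (Finset.mem_univ j), by
      rw [affineFun_apply, domRestrict_apply, hj, hmc]⟩
  · rintro ⟨hgc, P, hP⟩
    have hres : ∀ x : ↥(cube n), g x = Function.extend Subtype.val g 0 x.1 :=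
      fun x ↦ (Subtype.val_injective.extend_apply g 0 x).symm
    refine ⟨_, ⟨?_, P.card, fun j y ↦ (P.equivFin.symm j).1.1 +
      ∑ i, ((P.equivFin.symm j).1.2 i : ℝ) * y i, fun j ↦ ⟨_, _, fun y ↦ rfl⟩, ?_⟩, hres⟩
    · rw [continuousOn_iff_continuous_domRestrict]
      convert hgc using 1
      exact (funext hres).symm
    · intro x hx
      obtain ⟨p, hp, hpx⟩ := hP ⟨x, hx⟩
      refine ⟨P.equivFin ⟨p, hp⟩, ?_⟩
      rw [← hres ⟨x, hx⟩, hpx, affineFun_apply]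
      simp

theorem affineFun_mem_Mres (p : ℤ × (Fin n → ℤ)) : affineFun p ∈ Mres (cube n) :=
  mem_Mres_cube_iff.2 ⟨continuous_affineFun p, {p}, by simp⟩

theorem add_mem_Mres {f g : ↥(cube n) → ℝ} (hf : f ∈ Mres (cube n)) (hg : g ∈ Mres (cube n)) :
    f + g ∈ Mres (cube n) := by
  classical
  rw [mem_Mres_cube_iff] at *
  obtain ⟨hfc, P, hP⟩ := hf
  obtain ⟨hgc, Q, hQ⟩ := hg
  refine ⟨hfc.add hgc, (P ×ˢ Q).image fun r ↦ r.1 + r.2, fun x ↦ ?_⟩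
  obtain ⟨p, hp, hpx⟩ := hP x
  obtain ⟨q, hq, hqx⟩ := hQ x
  exact ⟨p + q, Finset.mem_image.2 ⟨(p, q), Finset.mem_product.2 ⟨hp, hq⟩, rfl⟩,
    by simp [hpx, hqx]⟩

theorem neg_mem_Mres {f : ↥(cube n) → ℝ} (hf : f ∈ Mres (cube n)) : -f ∈ Mres (cube n) := by
  classical
  rw [mem_Mres_cube_iff] at *
  obtain ⟨hfc, P, hP⟩ := hf
  refine ⟨hfc.neg, P.image Neg.neg, fun x ↦ ?_⟩
  obtain ⟨p, hp, hpx⟩ := hP x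
  exact ⟨-p, Finset.mem_image_of_mem _ hp, by simp [hpx]⟩

theorem sup_mem_Mres {f g : ↥(cube n) → ℝ} (hf : f ∈ Mres (cube n)) (hg : g ∈ Mres (cube n)) :
    f ⊔ g ∈ Mres (cube n) := by
  classical
  rw [mem_Mres_cube_iff] at *
  obtain ⟨hfc, P, hP⟩ := hf
  obtain ⟨hgc, Q, hQ⟩ := hg
  refine ⟨hfc.sup hgc, P ∪ Q, fun x ↦ ?_⟩
  obtain ⟨p, hp, hpx⟩ := hP x
  obtain ⟨q, hq, hqx⟩ := hQ x
  rcases le_total (f x) (g x) with h | h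
  · exact ⟨q, Finset.mem_union_right _ hq, (max_eq_right h).trans hqx⟩
  · exact ⟨p, Finset.mem_union_left _ hp, (max_eq_left h).trans hpx⟩

theorem inf_mem_Mres {f g : ↥(cube n) → ℝ} (hf : f ∈ Mres (cube n)) (hg : g ∈ Mres (cube n)) :
    f ⊓ g ∈ Mres (cube n) := by
  have h : f ⊓ g = -(-f ⊔ -g) := by simp [neg_sup]
  rw [h]
  exact neg_mem_Mres (sup_mem_Mres (neg_mem_Mres hf) (neg_mem_Mres hg))

theorem exists_affineFun_separating {f : ↥(cube n) → ℝ} (hf : Continuous f)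
    {P : Finset (ℤ × (Fin n → ℤ))} (hP : ∀ x, ∃ p ∈ P, f x = affineFun p x) (x y : ↥(cube n)) :
    ∃ p ∈ P, affineFun p x ≤ f x ∧ f y ≤ affineFun p y := by
  have hconv : Convex ℝ (cube n) := convex_Icc 0 1
  let γ : ℝ → Fin n → ℝ := fun t ↦ x.1 + t • (y.1 - x.1)
  have hγ : ∀ t ∈ Icc (0 : ℝ) 1, γ t ∈ cube n := fun t ht ↦
    hconv.add_smul_sub_mem x.2 y.2 ht
  have hγ0 : γ 0 = x.1 := by simp [γ]
  have hγ1 : γ 1 = y.1 := by simp [γ]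
  let G : (Fin n → ℝ) → ℝ := Function.extend Subtype.val f 0
  have hG : ∀ z : ↥(cube n), G z.1 = f z := fun z ↦ Subtype.val_injective.extend_apply f 0 z
  have hGc : ContinuousOn G (cube n) := by
    rw [continuousOn_iff_continuous_domRestrict]
    convert hf using 1
    exact funext hG
  have hline : ∀ (p : ℤ × (Fin n → ℤ)) (t : ℝ) (ht : γ t ∈ cube n),
      affineFun p ⟨γ t, ht⟩ = affineFun p x + (affineFun p y - affineFun p x) * t := by
    intro p t ht
    simp only [affineFun_apply, γ, Pi.add_apply, Pi.smul_apply, Pi.sub_apply, smul_eq_mul]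
    rw [add_sub_add_left_eq_sub, ← Finset.sum_sub_distrib, Finset.sum_mul, add_assoc,
      ← Finset.sum_add_distrib]
    congr 1
    exact Finset.sum_congr rfl fun i _ ↦ by ring
  obtain ⟨⟨p, hp⟩, h0, h1⟩ := exists_line_separating (κ := P) (g := G ∘ γ)
    (hGc.comp (by fun_prop) hγ) (fun p ↦ affineFun p.1 x)
    (fun p ↦ affineFun p.1 y - affineFun p.1 x) (fun t ht ↦ by
      obtain ⟨p, hp, hpt⟩ := hP ⟨γ t, hγ t ht⟩
      exact ⟨⟨p, hp⟩, by rw [← hline p t (hγ t ht), ← hpt, Function.comp_apply, ← hG]⟩)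
  refine ⟨p, hp, ?_, ?_⟩
  · rwa [Function.comp_apply, hγ0, hG] at h0
  · rwa [Function.comp_apply, hγ1, hG, add_sub_cancel] at h1

/-- Every element of `M_n` is a finite supremum of finite infima of integer affine functions. -/
theorem Mres_subset_latticeClosure :
    Mres (cube n) ⊆ latticeClosure (range (affineFun (n := n))) := by
  classical
  intro f hf
  obtain ⟨hfc, P, hP⟩ := mem_Mres_cube_iff.1 hf
  rw [← supClosure_infClosure]
  let T : ↥(cube n) → Finset (ℤ × (Fin n → ℤ)) := fun y ↦ P.filter fun p ↦ f y ≤ affineFun p y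
  have hT : ∀ y, (T y).Nonempty := fun y ↦ by
    obtain ⟨p, hp, hpy⟩ := hP y
    exact ⟨p, Finset.mem_filter.2 ⟨hp, hpy.le⟩⟩
  let F : ↥(cube n) → ↥(cube n) → ℝ := fun y ↦ (T y).inf' (hT y) affineFun
  have hfin : (range F).Finite := by
    refine (P.powerset.finite_toSet.image fun S ↦
      if h : S.Nonempty then S.inf' h affineFun else 0).subset ?_
    rintro _ ⟨y, rfl⟩
    exact ⟨T y, Finset.mem_coe.2 (Finset.mem_powerset.2 (Finset.filter_subset _ _)),
      by simp [F, hT y]⟩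
  have hne : hfin.toFinset.Nonempty :=
    ⟨F ⟨0, zero_mem_cube⟩, hfin.mem_toFinset.2 (mem_range_self _)⟩
  have hle : ∀ y, F y ≤ f := fun y x ↦ by
    obtain ⟨p, hp, hpx, hpy⟩ := exists_affineFun_separating hfc hP x y
    exact (Finset.inf'_le affineFun (Finset.mem_filter.2 ⟨hp, hpy⟩) x).trans hpx
  have hge : ∀ y, f y ≤ F y y := fun y ↦ by
    simp only [F, Finset.inf'_apply, Finset.le_inf'_iff]
    exact fun p hp ↦ (Finset.mem_filter.1 hp).2
  have hf_eq : f = hfin.toFinset.sup' hne id := by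
    refine le_antisymm (fun y ↦ ?_) (Finset.sup'_le _ _ ?_)
    · exact (hge y).trans (Finset.le_sup' id (hfin.mem_toFinset.2 ⟨y, rfl⟩) y)
    · simp only [Finite.mem_toFinset, forall_mem_range, id]
      exact hle
  rw [hf_eq]
  refine finsetSup'_mem_supClosure hne ?_
  simp only [Finite.mem_toFinset, forall_mem_range, id]
  exact fun y ↦ finsetInf'_mem_infClosure (hT y) fun p _ ↦ mem_range_self p

end Affine

section LatticeClosure

variable {G : Type*} [AddCommGroup G] [Lattice G] [IsOrderedAddMonoid G]

theorem neg_mem_latticeClosure (A : AddSubgroup G) {a : G}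
    (ha : a ∈ latticeClosure (A : Set G)) : -a ∈ latticeClosure (A : Set G) := by
  refine latticeClosure_min (t := Neg.neg ⁻¹' latticeClosure (A : Set G))
    (fun a ha ↦ subset_latticeClosure (A.neg_mem ha)) ⟨?_, ?_⟩ ha
  · intro a ha b hb
    simpa only [mem_preimage, neg_sup] using isSublattice_latticeClosure.infClosed ha hb
  · intro a ha b hb
    simpa only [mem_preimage, neg_inf] using isSublattice_latticeClosure.supClosed ha hb

theorem add_mem_latticeClosure (A : AddSubgroup G) {a b : G}
    (ha : a ∈ latticeClosure (A : Set G)) (hb : b ∈ latticeClosure (A : Set G)) :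
    a + b ∈ latticeClosure (A : Set G) := by
  have hsub : ∀ c, (∀ a ∈ A, a + c ∈ latticeClosure (A : Set G)) →
      ∀ a ∈ latticeClosure (A : Set G), a + c ∈ latticeClosure (A : Set G) := by
    intro c hc a ha
    refine latticeClosure_min (t := (· + c) ⁻¹' latticeClosure (A : Set G)) hc ⟨?_, ?_⟩ ha
    · intro a ha b hb
      simpa only [mem_preimage, sup_add] using isSublattice_latticeClosure.supClosed ha hb
    · intro a ha b hb
      simpa only [mem_preimage, inf_add] using isSublattice_latticeClosure.infClosed ha hb
  refine hsub b (fun a ha ↦ ?_) a ha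
  rw [add_comm]
  exact hsub a (fun b hb ↦ subset_latticeClosure (A.add_mem hb ha)) b hb

end LatticeClosure

section Free

variable {n : ℕ} {H : Type*} [AddCommGroup H] {v : H} {vs : Fin n → H}

section

variable [Lattice H] [IsOrderedAddMonoid H]

theorem sup'_affineHom_nonneg (hv : 0 ≤ v) (hvs : ∀ i, 0 ≤ vs i ∧ vs i ≤ v)
    {P : Finset (ℤ × (Fin n → ℤ))} (hne : P.Nonempty)
    (hP : ∀ x, ∃ p ∈ P, 0 ≤ affineFun p x) : 0 ≤ P.sup' hne (affineHom v vs) := by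
  set w := P.sup' hne (affineHom v vs)
  let E : (ℤ × (Fin n → ℤ)) × ℤ →+ H :=
    (affineHom v vs).coprod (zmultiplesHom H w)
  let L : List ((ℤ × (Fin n → ℤ)) × ℤ) :=
    P.toList.map (fun p ↦ (-p, 1)) ++ (((1, 0), 0) ::
      (List.ofFn fun i ↦ ((0, Pi.single i 1), 0)) ++ List.ofFn fun i ↦ ((1, -Pi.single i 1), 0))
  have hw : E (0, 1) = w := by simp [E]
  rw [← hw]
  have hsplit : ∀ i : Fin n,
      (1, -Pi.single i 1) = ((1, 0) - (0, Pi.single i 1) : ℤ × (Fin n → ℤ)) :=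
    fun i ↦ by simp
  refine transfer_linear_inequalities (fun r hr ↦ ?_) E L (0, 1) (fun x hx ↦ ?_) ?_
  · ext i
    · exact hr ((AddMonoidHom.fst _ _).comp (AddMonoidHom.fst _ _))
    · exact hr ((Pi.evalAddMonoidHom _ i).comp ((AddMonoidHom.snd _ _).comp (AddMonoidHom.fst _ _)))
    · exact hr (AddMonoidHom.snd _ _)
  · let φ : ℤ × (Fin n → ℤ) →+ ℤ := x.comp (AddMonoidHom.inl _ _)
    set t := x (0, 1)
    have hxt : ∀ p m, x (p, m) = φ p + m * t := by
      intro p m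
      have : (p, m) = (p, 0) + m • ((0 : ℤ × (Fin n → ℤ)), (1 : ℤ)) := by simp
      rw [this, map_add, map_zsmul, smul_eq_mul]
      rfl
    simp only [L, List.mem_append, List.mem_cons, List.mem_map, List.mem_ofFn, Finset.mem_toList,
      or_imp, forall_and, forall_exists_index, and_imp, forall_apply_eq_imp_iff₂, forall_eq,
      forall_apply_eq_imp_iff, hxt, hsplit, map_sub, map_neg, zero_mul, one_mul, add_zero,
      le_neg_add_iff_add_le, sub_nonneg] at hx
    obtain ⟨hxP, ⟨hx0, hxi⟩, hxi'⟩ := hx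
    have hφ := addMonoidHom_apply_eq_affineHom φ
    rcases hx0.eq_or_lt with h0 | h0
    · have hzero : ∀ i, φ (0, Pi.single i 1) = 0 := fun i ↦
        le_antisymm (h0 ▸ hxi' i) (hxi i)
      obtain ⟨p, hp⟩ := hne
      have := hxP p hp
      rwa [hφ, ← h0, funext hzero, affineHom_apply, smul_zero, zero_add,
        Finset.sum_eq_zero fun i _ ↦ smul_zero _] at this
    · have h0' : (0 : ℝ) < φ (1, 0) := by exact_mod_cast h0
      let y : ↥(cube n) := ⟨fun i ↦ (φ (0, Pi.single i 1) : ℝ) / φ (1, 0),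
        fun i ↦ div_nonneg (Int.cast_nonneg (hxi i)) h0'.le,
        fun i ↦ (div_le_one h0').2 (by exact_mod_cast hxi' i)⟩
      obtain ⟨p, hp, hpy⟩ := hP y
      refine le_trans ?_ (hxP p hp)
      have hval : (φ p : ℝ) = φ (1, 0) * affineFun p y := by
        rw [hφ, affineHom_apply, affineFun_apply, mul_add, Finset.mul_sum]
        push_cast [smul_eq_mul]
        congr 1
        · ring
        · refine Finset.sum_congr rfl fun i _ ↦ ?_
          simp only [y]
          field_simp
      have : (0 : ℝ) ≤ φ p := hval ▸ mul_nonneg h0'.le hpy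
      exact_mod_cast this
  · simp only [L, List.mem_append, List.mem_cons, List.mem_map, List.mem_ofFn, Finset.mem_toList,
      or_imp, forall_and, forall_exists_index, and_imp, forall_apply_eq_imp_iff₂, forall_eq,
      forall_apply_eq_imp_iff, hsplit]
    refine ⟨fun p hp ↦ ?_, ⟨?_, fun i ↦ ?_⟩, fun i ↦ ?_⟩
    · simpa [E] using Finset.le_sup' (affineHom v vs) hp
    · simpa [E, affineHom_one_zero] using hv
    · simpa [E, affineHom_zero_single] using (hvs i).1
    · simpa [E, affineHom_zero_single, affineHom_one_zero, -Prod.mk_sub_mk] using (hvs i).2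

end

section

variable [DistribLattice H]

variable (v vs) in
/-- The ℓ-subgroup of `M_n × H` generated by `(1, v)` and the `(π_i, v_i)`. It is the graph of
the universal homomorphism. -/
def graphLattice : Set ((↥(cube n) → ℝ) × H) :=
  latticeClosure ((affineHom (1, v) fun i ↦ (coordFun i, vs i)).range : Set _)

theorem affineFun_mem_graphLattice (p : ℤ × (Fin n → ℤ)) :
    (affineFun p, affineHom v vs p) ∈ graphLattice v vs := by
  refine subset_latticeClosure ⟨p, Prod.ext ?_ ?_⟩
  · exact map_affineHom (AddMonoidHom.fst (↥(cube n) → ℝ) H) _ _ p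
  · exact map_affineHom (AddMonoidHom.snd (↥(cube n) → ℝ) H) _ _ p

theorem nonneg_of_mem_graphLattice [IsOrderedAddMonoid H] (hv : 0 ≤ v)
    (hvs : ∀ i, 0 ≤ vs i ∧ vs i ≤ v)
    {r : (↥(cube n) → ℝ) × H} (hr : r ∈ graphLattice v vs) (h : 0 ≤ r.1) : 0 ≤ r.2 := by
  classical
  rw [graphLattice, ← infClosure_supClosure] at hr
  obtain ⟨s, hs, hsA, rfl⟩ := hr
  have key : ∀ a ∈ s, 0 ≤ a.1 → 0 ≤ a.2 := by
    intro a ha ha1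
    obtain ⟨t, ht, htA, rfl⟩ := hsA ha
    have hrange : ∀ b ∈ t, ∃ p, affineHom (1, v) (fun i ↦ (coordFun i, vs i)) p = b :=
      fun b hb ↦ htA hb
    choose! c hc using hrange
    have hc1 : ∀ b ∈ t, b.1 = affineFun (c b) := fun b hb ↦ by
      nth_rw 1 [← hc b hb]
      exact map_affineHom (AddMonoidHom.fst (↥(cube n) → ℝ) H) _ _ _
    have hc2 : ∀ b ∈ t, b.2 = affineHom v vs (c b) := fun b hb ↦ by
      nth_rw 1 [← hc b hb]
      exact map_affineHom (AddMonoidHom.snd (↥(cube n) → ℝ) H) _ _ _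
    refine (sup'_affineHom_nonneg hv hvs (ht.image c) fun x ↦ ?_).trans
      (Finset.sup'_le _ _ fun p hp ↦ ?_)
    · have hx := ha1 x
      rw [Finset.apply_sup'_eq_sup'_comp ht Prod.fst fun _ _ ↦ rfl, Finset.sup'_apply] at hx
      obtain ⟨b, hb, hbx⟩ := (Finset.le_sup'_iff ht).1 hx
      refine ⟨c b, Finset.mem_image_of_mem c hb, ?_⟩
      rw [← hc1 b hb]
      exact hbx
    · obtain ⟨b, hb, rfl⟩ := Finset.mem_image.1 hp
      rw [← hc2 b hb]
      exact (Finset.le_sup' id hb).2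
  have h2 : ∀ a ∈ s, 0 ≤ a.2 := fun a ha ↦
    key a ha (h.trans (Finset.inf'_le id ha).1)
  rw [Finset.apply_inf'_eq_inf'_comp hs Prod.snd fun _ _ ↦ rfl]
  exact Finset.le_inf' _ _ h2

theorem snd_le_of_mem_graphLattice [IsOrderedAddMonoid H] (hv : 0 ≤ v)
    (hvs : ∀ i, 0 ≤ vs i ∧ vs i ≤ v)
    {f : ↥(cube n) → ℝ} {h₁ h₂ : H} (hh₁ : (f, h₁) ∈ graphLattice v vs)
    (hh₂ : (f, h₂) ∈ graphLattice v vs) : h₁ ≤ h₂ := by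
  have := nonneg_of_mem_graphLattice hv hvs
    (add_mem_latticeClosure _ hh₂ (neg_mem_latticeClosure _ hh₁)) (by simp)
  simpa [← sub_eq_add_neg] using this

theorem exists_mem_graphLattice {f : ↥(cube n) → ℝ} (hf : f ∈ Mres (cube n)) :
    ∃ h, (f, h) ∈ graphLattice v vs := by
  refine latticeClosure_min (t := {f | ∃ h, (f, h) ∈ graphLattice v vs}) ?_ ⟨?_, ?_⟩
    (Mres_subset_latticeClosure hf)
  · rintro _ ⟨p, rfl⟩
    exact ⟨_, affineFun_mem_graphLattice p⟩
  · rintro f ⟨h, hf⟩ g ⟨k, hg⟩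
    exact ⟨h ⊔ k, isSublattice_latticeClosure.supClosed hf hg⟩
  · rintro f ⟨h, hf⟩ g ⟨k, hg⟩
    exact ⟨h ⊓ k, isSublattice_latticeClosure.infClosed hf hg⟩

theorem exists_unitalHomOn [IsOrderedAddMonoid H] (hv : 0 ≤ v)
    (hvs : ∀ i, 0 ≤ vs i ∧ vs i ≤ v) :
    ∃ η, UnitalHomOn n H v vs η := by
  classical
  have hex : ∀ f : ↥(cube n) → ℝ, ∃ h, f ∈ Mres (cube n) → (f, h) ∈ graphLattice v vs := by
    intro f
    by_cases hf : f ∈ Mres (cube n)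
    · exact (exists_mem_graphLattice hf).imp fun _ hh _ ↦ hh
    · exact ⟨0, fun h ↦ absurd h hf⟩
  choose η hη using hex
  have huniq : ∀ {f h}, f ∈ Mres (cube n) → (f, h) ∈ graphLattice v vs → η f = h :=
    fun hf hh ↦ le_antisymm (snd_le_of_mem_graphLattice hv hvs (hη _ hf) hh)
      (snd_le_of_mem_graphLattice hv hvs hh (hη _ hf))
  have haff : ∀ p, η (affineFun p) = affineHom v vs p := fun p ↦
    huniq (affineFun_mem_Mres p) (affineFun_mem_graphLattice p)
  refine ⟨η, fun f hf g hg ↦ ?_, fun f hf g hg ↦ ?_, fun f hf g hg ↦ ?_, ?_, fun i ↦ ?_⟩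
  · exact huniq (add_mem_Mres hf hg) (add_mem_latticeClosure _ (hη f hf) (hη g hg))
  · exact huniq (sup_mem_Mres hf hg) (isSublattice_latticeClosure.supClosed (hη f hf) (hη g hg))
  · exact huniq (inf_mem_Mres hf hg) (isSublattice_latticeClosure.infClosed (hη f hf) (hη g hg))
  · simpa only [affineFun, affineHom_one_zero] using haff (1, 0)
  · exact (by simpa only [affineFun, affineHom_zero_single] using haff (0, Pi.single i 1) :
      η (coordFun i) = vs i)

end

theorem Mres_subset_of_closed {S : Set (↥(cube n) → ℝ)}
    (hcoord : ∀ i : Fin n, (fun x : ↥(cube n) ↦ x.1 i) ∈ S) (hone : (1 : ↥(cube n) → ℝ) ∈ S)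
    (hzero : (0 : ↥(cube n) → ℝ) ∈ S) (hadd : ∀ f ∈ S, ∀ g ∈ S, f + g ∈ S)
    (hneg : ∀ f ∈ S, -f ∈ S) (hsup : ∀ f ∈ S, ∀ g ∈ S, f ⊔ g ∈ S)
    (hinf : ∀ f ∈ S, ∀ g ∈ S, f ⊓ g ∈ S) : Mres (cube n) ⊆ S := by
  let A : AddSubgroup (↥(cube n) → ℝ) :=
    { carrier := S
      add_mem' := fun hf hg ↦ hadd _ hf _ hg
      zero_mem' := hzero
      neg_mem' := fun hf ↦ hneg _ hf }
  refine Mres_subset_latticeClosure.trans (latticeClosure_min ?_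
    ⟨fun f hf g hg ↦ hsup f hf g hg, fun f hf g hg ↦ hinf f hf g hg⟩)
  rintro _ ⟨p, rfl⟩
  exact A.add_mem (A.zsmul_mem hone p.1) (A.sum_mem fun i _ ↦ A.zsmul_mem (hcoord i) _)

theorem UnitalHomOn.eqOn [Lattice H] {η η' : (↥(cube n) → ℝ) → H}
    (h : UnitalHomOn n H v vs η) (h' : UnitalHomOn n H v vs η') :
    EqOn η η' (Mres (cube n)) := by
  obtain ⟨hadd, hsup, hinf, hone, hcoord⟩ := h
  obtain ⟨hadd', hsup', hinf', hone', hcoord'⟩ := h'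
  have hmem0 : (0 : ↥(cube n) → ℝ) ∈ Mres (cube n) := by
    simpa only [map_zero] using affineFun_mem_Mres (n := n) 0
  have h0 : η 0 = 0 := by simpa using hadd 0 hmem0 0 hmem0
  have h0' : η' 0 = 0 := by simpa using hadd' 0 hmem0 0 hmem0
  have hsub : Mres (cube n) ⊆ {f | f ∈ Mres (cube n) ∧ η f = η' f} := by
    refine Mres_subset_of_closed (fun i ↦ ⟨?_, ?_⟩) ⟨?_, ?_⟩ ⟨hmem0, h0.trans h0'.symm⟩ ?_ ?_ ?_ ?_
    · exact (by simpa only [affineFun, affineHom_zero_single] using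
        affineFun_mem_Mres (0, Pi.single i 1) : coordFun i ∈ Mres (cube n))
    · rw [hcoord, hcoord']
    · simpa only [affineFun, affineHom_one_zero] using affineFun_mem_Mres (n := n) (1, 0)
    · rw [hone, hone']
    · rintro f ⟨hf, hfe⟩ g ⟨hg, hge⟩
      exact ⟨add_mem_Mres hf hg, by rw [hadd f hf g hg, hadd' f hf g hg, hfe, hge]⟩
    · rintro f ⟨hf, hfe⟩
      refine ⟨neg_mem_Mres hf, ?_⟩
      have h1 := hadd f hf (-f) (neg_mem_Mres hf)
      have h2 := hadd' f hf (-f) (neg_mem_Mres hf)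
      rw [add_neg_cancel, h0, hfe] at h1
      rw [add_neg_cancel, h0'] at h2
      exact add_left_cancel (h1.symm.trans h2)
    · rintro f ⟨hf, hfe⟩ g ⟨hg, hge⟩
      exact ⟨sup_mem_Mres hf hg, by rw [hsup f hf g hg, hsup' f hf g hg, hfe, hge]⟩
    · rintro f ⟨hf, hfe⟩ g ⟨hg, hge⟩
      exact ⟨inf_mem_Mres hf hg, by rw [hinf f hf g hg, hinf' f hf g hg, hfe, hge]⟩
  exact fun f hf ↦ (hsub hf).2

end Free

/-- (a) `M_n` is generated, as a group closed under `⊔` and `⊓`, by the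
coordinate functions `π_1, …, π_n` together with the constant function `1`; (b) for every
unital ℓ-group `(H, v)` and elements `0 ≤ v_i ≤ v`, there is a unique unital
ℓ-homomorphism `η : (M_n, 1) → (H, v)` with `η(π_i) = v_i`. -/
theorem stmt5 {n : ℕ} (hn : 1 ≤ n)
    (H : Type*) [AddCommGroup H] [Lattice H] [CovariantClass H H (· + ·) (· ≤ ·)]
    (v : H) (hv : 0 ≤ v) (harch : ∀ x : H, ∃ m : ℕ, 0 < m ∧ x ≤ m • v)
    (vs : Fin n → H) (hvs : ∀ i, 0 ≤ vs i ∧ vs i ≤ v) :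
    (∀ S : Set (↥(cube n) → ℝ), S ⊆ Mres (cube n) →
      (∀ i : Fin n, (fun x : ↥(cube n) => x.1 i) ∈ S) →
      (1 : ↥(cube n) → ℝ) ∈ S → (0 : ↥(cube n) → ℝ) ∈ S →
      (∀ f ∈ S, ∀ g ∈ S, f + g ∈ S) → (∀ f ∈ S, -f ∈ S) →
      (∀ f ∈ S, ∀ g ∈ S, f ⊔ g ∈ S) → (∀ f ∈ S, ∀ g ∈ S, f ⊓ g ∈ S) →
      Mres (cube n) ⊆ S) ∧
    (∃ η : (↥(cube n) → ℝ) → H, UnitalHomOn n H v vs η ∧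
      ∀ η' : (↥(cube n) → ℝ) → H, UnitalHomOn n H v vs η' →
        ∀ f ∈ Mres (cube n), η f = η' f) := by
  have : IsOrderedAddMonoid H := ⟨fun _ _ h c ↦ add_le_add_left h c,
    fun _ _ h c ↦ add_le_add_right h c⟩
  refine ⟨fun S _ hcoord hone hzero hadd hneg hsup hinf ↦
    Mres_subset_of_closed hcoord hone hzero hadd hneg hsup hinf, ?_⟩
  obtain ⟨η, hη⟩ := @exists_unitalHomOn n H _ v vs (AddCommGroup.toDistribLattice H) this hv hvs
  exact ⟨η, hη, fun η' hη' ↦ UnitalHomOn.eqOn hη hη'⟩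
end

section
/- Let A ⊆ [0,1] be an MV-subalgebra of the standard MV-algebra [0,1]. Then every MV-endomorphism σ : A → A (a map with σ(0) = 0, σ(¬x) = ¬σ(x) and σ(x ⊕ y) = σ(x) ⊕ σ(y)) is the identity map on A. In particular, every simple MV-algebra, i.e., every MV-subalgebra of [0,1], is hopfian. -/
theorem nonpos_of_forall_two_pow_mul_le_one {c : ℝ} (h : ∀ n : ℕ, 2 ^ n * c ≤ 1) : c ≤ 0 := by
  by_contra! hc
  obtain ⟨n, hn⟩ := pow_unbounded_of_one_lt (1 / c) (one_lt_two : (1 : ℝ) < 2)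
  rw [div_lt_iff₀ hc] at hn
  linarith [h n]

/-- if `A ⊆ [0,1]` is an MV-subalgebra of the standard MV-algebra `[0,1]`
(with `¬x = 1 - x` and `x ⊕ y = min 1 (x + y)`), then every MV-endomorphism `σ` of `A`
is the identity on `A`; in particular every simple MV-algebra is hopfian. -/
theorem stmt7 (A : Set ℝ) (hA : A ⊆ Set.Icc 0 1) (h0 : (0:ℝ) ∈ A)
    (hneg : ∀ x ∈ A, 1 - x ∈ A) (hoplus : ∀ x ∈ A, ∀ y ∈ A, min 1 (x + y) ∈ A)
    (σ : ℝ → ℝ) (hmaps : Set.MapsTo σ A A) (hσ0 : σ 0 = 0)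
    (hσneg : ∀ x ∈ A, σ (1 - x) = 1 - σ x)
    (hσop : ∀ x ∈ A, ∀ y ∈ A, σ (min 1 (x + y)) = min 1 (σ x + σ y)) :
    ∀ x ∈ A, σ x = x := by
  have hσ1 : σ 1 = 1 := by simpa [hσ0] using hσneg 0 h0
  have double_mem : ∀ x ∈ A, x ≤ 1 / 2 → 2 * x ∈ A ∧ σ (2 * x) = min 1 (2 * σ x) := by
    intro x hx hx2
    have hm := hoplus x hx x hx
    have hs := hσop x hx x hx
    rw [min_eq_right (by linarith)] at hm hs
    simp only [← two_mul] at hm hs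
    exact ⟨hm, hs⟩
  have map_of_half_le : ∀ x ∈ A, 1 / 2 ≤ x → 1 / 2 ≤ σ x := by
    intro x hx hx2
    have hs := hσop x hx x hx
    rw [min_eq_left (by linarith), hσ1] at hs
    linarith [min_le_right 1 (σ x + σ x)]
  have map_of_le_half : ∀ x ∈ A, x ≤ 1 / 2 → σ x ≤ 1 / 2 := by
    intro x hx hx2
    have := map_of_half_le (1 - x) (hneg x hx) (by linarith)
    rw [hσneg x hx] at this
    linarith
  have dist_bound : ∀ n : ℕ, ∀ x ∈ A, 2 ^ n * |σ x - x| ≤ 1 := by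
    intro n
    induction n with
    | zero =>
      intro x hx
      have h1 := hA hx
      have h2 := hA (hmaps hx)
      rw [pow_zero, one_mul, abs_le]
      constructor <;> linarith [h1.1, h1.2, h2.1, h2.2]
    | succ n ih =>
      have low : ∀ x ∈ A, x ≤ 1 / 2 → 2 ^ (n + 1) * |σ x - x| ≤ 1 := by
        intro x hx h
        obtain ⟨hm, hs⟩ := double_mem x hx h
        have := ih (2 * x) hm
        rw [hs, min_eq_right (by linarith [map_of_le_half x hx h]), ← mul_sub, abs_mul,
          abs_two, ← mul_assoc, ← pow_succ] at this
        exact this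
      intro x hx
      rcases le_total x (1 / 2) with h | h
      · exact low x hx h
      · have := low (1 - x) (hneg x hx) (by linarith)
        rwa [hσneg x hx, sub_sub_sub_cancel_left, abs_sub_comm] at this
  intro x hx
  have := nonpos_of_forall_two_pow_mul_le_one fun n => dist_bound n x hx
  exact sub_eq_zero.mp (abs_nonpos_iff.mp this)
end

section
/- Every finitely generated unital ℓ-group (G, u) having only finitely many prime ideals is hopfian: every surjective unital ℓ-homomorphism of (G, u) onto itself is injective. -/
/-- `x ⊔ (-x)`, the absolute value in a lattice-ordered abelian group. -/
def gabs {G : Type*} [Lattice G] [AddCommGroup G] (x : G) : G := x ⊔ (-x)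

/-- An ideal of the unital ℓ-group `(G, u)`: a subgroup not containing `u` which is
order-convex with respect to absolute values. -/
def IsIdeal {G : Type*} [Lattice G] [AddCommGroup G] (u : G) (I : Set G) : Prop :=
  (0:G) ∈ I ∧ (∀ a ∈ I, ∀ b ∈ I, a + b ∈ I) ∧ (∀ a ∈ I, -a ∈ I) ∧ u ∉ I ∧
  ∀ x y : G, y ∈ I → gabs x ≤ gabs y → x ∈ I

/-- A prime ideal of the unital ℓ-group `(G, u)`. -/
def IsPrimeIdeal {G : Type*} [Lattice G] [AddCommGroup G] (u : G) (I : Set G) : Prop :=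
  IsIdeal u I ∧ ∀ a b : G, 0 ≤ a → 0 ≤ b → a ⊓ b ∈ I → a ∈ I ∨ b ∈ I

section LatticeGroup

variable {G : Type*} [AddCommGroup G] [Lattice G]

theorem gabs_neg (x : G) : gabs (-x) = gabs x := abs_neg x

theorem IsIdeal.mem_of_gabs_le {u : G} {I : Set G} (hI : IsIdeal u I) {x y : G} (hy : y ∈ I)
    (h : gabs x ≤ y) : x ∈ I :=
  hI.2.2.2.2 x y hy (h.trans le_sup_left)

theorem IsIdeal.nsmul_mem {u : G} {I : Set G} (hI : IsIdeal u I) {x : G} (hx : x ∈ I)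
    (n : ℕ) : n • x ∈ I := by
  induction n with
  | zero => simpa using hI.1
  | succ n ih =>
    rw [succ_nsmul]
    exact hI.2.1 _ ih _ hx

variable [IsOrderedAddMonoid G]

theorem gabs_add_le (x y : G) : gabs (x + y) ≤ gabs x + gabs y := by
  refine sup_le (add_le_add le_sup_left le_sup_left) ?_
  rw [neg_add]
  exact add_le_add le_sup_right le_sup_right

theorem gabs_nonneg (x : G) : 0 ≤ gabs x := abs_nonneg x

theorem gabs_zero : gabs (0 : G) = 0 := abs_zero

theorem gabs_of_nonneg {x : G} (hx : 0 ≤ x) : gabs x = x := abs_of_nonneg hx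

theorem eq_zero_of_gabs_le_zero {x : G} (hx : gabs x ≤ 0) : x = 0 :=
  le_antisymm (le_sup_left.trans hx) (neg_nonpos.mp (le_sup_right.trans hx))

theorem inf_add_le_inf_add_inf {x y z : G} (hx : 0 ≤ x) (hy : 0 ≤ y) (hz : 0 ≤ z) :
    x ⊓ (y + z) ≤ x ⊓ y + x ⊓ z := by
  rw [← sub_le_iff_le_add']
  refine le_inf ?_ ?_
  · exact (sub_le_self _ (le_inf hx hy)).trans inf_le_left
  · rw [sub_le_iff_le_add', ← sub_le_iff_le_add]
    exact le_inf ((sub_le_self _ hz).trans inf_le_left) (sub_le_iff_le_add.mpr inf_le_right)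

theorem inf_nsmul_le_nsmul_inf {x y : G} (hx : 0 ≤ x) (hy : 0 ≤ y) (n : ℕ) :
    x ⊓ n • y ≤ n • (x ⊓ y) := by
  induction n with
  | zero => simp
  | succ n ih =>
    rw [succ_nsmul, succ_nsmul]
    exact (inf_add_le_inf_add_inf hx (nsmul_nonneg hy n) hy).trans (add_le_add_left ih _)

theorem IsIdeal.gabs_mem {u : G} {I : Set G} (hI : IsIdeal u I) {x : G} (hx : x ∈ I) :
    gabs x ∈ I :=
  hI.2.2.2.2 _ x hx (gabs_of_nonneg (gabs_nonneg x)).le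

/-- The absolutely convex subgroup generated by an ideal `I` and a positive element `b`. -/
def idealAdjoin (I : Set G) (b : G) : Set G :=
  {x | ∃ i ∈ I, ∃ n : ℕ, gabs x ≤ i + n • b}

theorem subset_idealAdjoin {u : G} {I : Set G} (hI : IsIdeal u I) (b : G) :
    I ⊆ idealAdjoin I b := fun x hx => ⟨gabs x, hI.gabs_mem hx, 0, by simp⟩

theorem mem_idealAdjoin_self {u : G} {I : Set G} (hI : IsIdeal u I) {b : G} (hb : 0 ≤ b) :
    b ∈ idealAdjoin I b := ⟨0, hI.1, 1, by simp [gabs_of_nonneg hb]⟩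

theorem isIdeal_idealAdjoin {u : G} {I : Set G} (hI : IsIdeal u I) {b : G}
    (hu : u ∉ idealAdjoin I b) : IsIdeal u (idealAdjoin I b) := by
  refine ⟨subset_idealAdjoin hI b hI.1, ?_, ?_, hu, ?_⟩
  · rintro x ⟨i, hi, n, hx⟩ y ⟨j, hj, m, hy⟩
    refine ⟨i + j, hI.2.1 _ hi _ hj, n + m, (gabs_add_le x y).trans ((add_le_add hx hy).trans ?_)⟩
    rw [add_nsmul, add_add_add_comm]
  · rintro x ⟨i, hi, n, hx⟩
    exact ⟨i, hi, n, by rwa [gabs_neg]⟩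
  · rintro x y ⟨i, hi, n, hy⟩ h
    exact ⟨i, hi, n, h.trans hy⟩

theorem IsIdeal.idealAdjoin_inter_subset {u : G} {I : Set G} (hI : IsIdeal u I) {b c : G}
    (hb : 0 ≤ b) (hc : 0 ≤ c) (hbc : b ⊓ c ∈ I) :
    idealAdjoin I b ∩ idealAdjoin I c ⊆ I := by
  rintro x ⟨⟨i, hi, n, hx⟩, ⟨j, hj, m, hy⟩⟩
  have hk : gabs i + gabs j ∈ I := hI.2.1 _ (hI.gabs_mem hi) _ (hI.gabs_mem hj)
  have hi' : i ≤ gabs i + gabs j := le_sup_left.trans (le_add_of_nonneg_right (gabs_nonneg j))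
  have hj' : j ≤ gabs i + gabs j := le_sup_left.trans (le_add_of_nonneg_left (gabs_nonneg i))
  have h : n • b ⊓ m • c ≤ m • n • (b ⊓ c) := by
    refine (inf_nsmul_le_nsmul_inf (nsmul_nonneg hb n) hc m).trans (nsmul_le_nsmul_right ?_ m)
    rw [inf_comm, inf_comm b]
    exact inf_nsmul_le_nsmul_inf hc hb n
  refine hI.mem_of_gabs_le (hI.2.1 _ hk _ (hI.nsmul_mem (hI.nsmul_mem hbc n) m)) ?_
  refine le_trans ?_ (add_le_add_right h _)
  rw [add_inf]
  exact le_inf (hx.trans (add_le_add_left hi' _)) (hy.trans (add_le_add_left hj' _))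

theorem exists_isPrimeIdeal_notMem {u : G} (harch : ∀ x : G, ∃ m : ℕ, 0 < m ∧ x ≤ m • u)
    {a : G} (ha : a ≠ 0) : ∃ I : Set G, IsPrimeIdeal u I ∧ a ∉ I := by
  have huz : u ≠ 0 := by
    rintro rfl
    obtain ⟨m, -, hm⟩ := harch (gabs a)
    exact ha (eq_zero_of_gabs_le_zero (by simpa using hm))
  have hzero : ({0} : Set G) ∈ {I : Set G | IsIdeal u I ∧ a ∉ I} := by
    refine ⟨⟨rfl, by simp, by simp, huz, ?_⟩, ha⟩
    rintro x y rfl h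
    exact eq_zero_of_gabs_le_zero (h.trans_eq gabs_zero)
  obtain ⟨M, -, hM⟩ := zorn_subset_nonempty {I : Set G | IsIdeal u I ∧ a ∉ I} (by
    intro c hc hchain hne
    refine ⟨⋃₀ c, ⟨⟨?_, ?_, ?_, ?_, ?_⟩, ?_⟩, fun s hs => Set.subset_sUnion_of_mem hs⟩
    · exact ⟨_, hne.some_mem, (hc hne.some_mem).1.1⟩
    · rintro x ⟨I, hI, hx⟩ y ⟨J, hJ, hy⟩
      rcases hchain.total hI hJ with h | h
      · exact ⟨J, hJ, (hc hJ).1.2.1 _ (h hx) _ hy⟩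
      · exact ⟨I, hI, (hc hI).1.2.1 _ hx _ (h hy)⟩
    · rintro x ⟨I, hI, hx⟩
      exact ⟨I, hI, (hc hI).1.2.2.1 _ hx⟩
    · rintro ⟨I, hI, hx⟩
      exact (hc hI).1.2.2.2.1 hx
    · rintro x y ⟨I, hI, hy⟩ h
      exact ⟨I, hI, (hc hI).1.2.2.2.2 x y hy h⟩
    · rintro ⟨I, hI, hx⟩
      exact (hc hI).2 hx) {0} hzero
  have hMI : IsIdeal u M := hM.prop.1
  have key : ∀ b : G, 0 ≤ b → b ∉ M → a ∈ idealAdjoin M b := by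
    intro b hb hbM
    by_contra hab
    by_cases hu : u ∈ idealAdjoin M b
    · obtain ⟨i, hi, n, hn⟩ := hu
      obtain ⟨m, -, hm⟩ := harch (gabs a)
      refine hab ⟨m • i, hMI.nsmul_mem hi m, m * n, hm.trans ?_⟩
      rw [mul_nsmul', ← nsmul_add]
      exact nsmul_le_nsmul_right (le_sup_left.trans hn) m
    · exact hbM (hM.le_of_ge (y := idealAdjoin M b) ⟨isIdeal_idealAdjoin hMI hu, hab⟩
        (subset_idealAdjoin hMI b) (mem_idealAdjoin_self hMI hb))
  refine ⟨M, ⟨hMI, fun b c hb hc hbc => ?_⟩, hM.prop.2⟩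
  by_contra! h
  exact hM.prop.2 (hMI.idealAdjoin_inter_subset hb hc hbc ⟨key b hb h.1, key c hc h.2⟩)

theorem IsPrimeIdeal.preimage {u : G} {I : Set G} (hI : IsPrimeIdeal u I) {σ : G → G}
    (hadd : ∀ a b : G, σ (a + b) = σ a + σ b) (hsup : ∀ a b : G, σ (a ⊔ b) = σ a ⊔ σ b)
    (hinf : ∀ a b : G, σ (a ⊓ b) = σ a ⊓ σ b) (hu : σ u = u) :
    IsPrimeIdeal u (σ ⁻¹' I) := by
  obtain ⟨⟨h0, ha, hn, hun, hc⟩, hp⟩ := hI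
  have hσ0 : σ 0 = 0 := by simpa using hadd 0 0
  have hσn : ∀ x, σ (-x) = -σ x := map_neg (AddMonoidHom.mk' σ hadd)
  have hmono : Monotone σ := fun x y h => by
    rw [← sup_eq_right, ← hsup, sup_eq_right.mpr h]
  have hσabs : ∀ x, σ (gabs x) = gabs (σ x) := fun x => by simp only [gabs, hsup, hσn]
  refine ⟨⟨?_, ?_, ?_, ?_, ?_⟩, ?_⟩
  · simpa [hσ0] using h0
  · intro a ha' b hb'
    simpa [hadd] using ha _ ha' _ hb'
  · intro a ha'
    simpa [hσn] using hn _ ha'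
  · simpa [hu] using hun
  · intro x y hy h
    exact hc _ _ hy (by simpa only [hσabs] using hmono h)
  · intro a b ha' hb' hab
    refine hp _ _ ?_ ?_ ?_
    · simpa only [hσ0] using hmono ha'
    · simpa only [hσ0] using hmono hb'
    · rwa [← hinf]

end LatticeGroup

/-- every finitely generated unital ℓ-group `(G, u)` with only finitely many
prime ideals is hopfian: every surjective unital ℓ-homomorphism of `(G, u)` onto itself is
injective. -/
theorem stmt8 (G : Type*) [AddCommGroup G] [Lattice G]
    [CovariantClass G G (· + ·) (· ≤ ·)]
    (u : G) (hu : 0 ≤ u) (harch : ∀ x : G, ∃ m : ℕ, 0 < m ∧ x ≤ m • u)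
    (hfg : ∃ F : Finset G, ∀ S : Set G,
      (∀ x ∈ F, x ∈ S) → u ∈ S → (0:G) ∈ S →
      (∀ a ∈ S, ∀ b ∈ S, a + b ∈ S) → (∀ a ∈ S, -a ∈ S) →
      (∀ a ∈ S, ∀ b ∈ S, a ⊔ b ∈ S) → (∀ a ∈ S, ∀ b ∈ S, a ⊓ b ∈ S) →
      ∀ x : G, x ∈ S)
    (hfin : {I : Set G | IsPrimeIdeal u I}.Finite) :
    ∀ σ : G → G, (∀ a b : G, σ (a + b) = σ a + σ b) →
      (∀ a b : G, σ (a ⊔ b) = σ a ⊔ σ b) → (∀ a b : G, σ (a ⊓ b) = σ a ⊓ σ b) →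
      σ u = u → Function.Surjective σ → Function.Injective σ := by
  intro σ hadd hsup hinf hσu hsurj
  have : IsOrderedAddMonoid G :=
    { add_le_add_left := fun a b h c => by
        rw [add_comm a, add_comm b]
        exact CovariantClass.elim (μ := (· + ·)) (r := (· ≤ ·)) c h }
  have hmaps : Set.MapsTo (σ ⁻¹' ·) {I : Set G | IsPrimeIdeal u I} {I | IsPrimeIdeal u I} :=
    fun I hI => IsPrimeIdeal.preimage hI hadd hsup hinf hσu
  have hsurjOn := ((hfin.injOn_iff_bijOn_of_mapsTo hmaps).mp
    hsurj.preimage_injective.injOn).surjOn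
  refine (injective_iff_map_eq_zero (AddMonoidHom.mk' σ hadd)).mpr fun x hx => ?_
  by_contra hx0
  obtain ⟨I, hI, hxI⟩ := exists_isPrimeIdeal_notMem harch hx0
  obtain ⟨J, hJ, rfl⟩ := hsurjOn hI
  have hσx : σ x = 0 := hx
  exact hxI (by simpa [hσx] using hJ.1.1)
end
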